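/- There exist public budgets b_1, b_2 > 0 (for instance b_1 = 3 and b_2 = 11) such that no deterministic two-bidder two-item mechanism with these public budgets and private diminishing marginal valuations is simultaneously incentive compatible, Pareto optimal, bidder rational, auctioneer rational, and free of positive transfers (p_i ≥ 0 always). -/

import Mathlib

/-!
STATEMENT 16: impossibility for private diminishing marginal
valuations.  There exist public budgets `b1, b2 > 0` (e.g. `b1 = 3`,
`b2 = 11`) such that no deterministic two-bidder two-item mechanism is
simultaneously incentive compatible, Pareto optimal, bidder rational,
auctioneer rational, and free of positive transfers.

A reported valuation is a pair `(v(1), v(2)) : ℝ × ℝ` with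
`v(1) ≥ v(2) ≥ 0`.  A mechanism is given by a quantity function `Q`
and a payment function `P`.
-/

/-- A diminishing marginal valuation for two items. -/
def Dim (v : ℝ × ℝ) : Prop := 0 ≤ v.2 ∧ v.2 ≤ v.1

/-- Total value of receiving `q` items under marginal valuation `v`. -/
def val2 (v : ℝ × ℝ) (q : ℕ) : ℝ :=
  match q with
  | 0 => 0
  | 1 => v.1
  | _ => v.1 + v.2

theorem stmt16 :
    ∃ b1 b2 : ℝ, 0 < b1 ∧ 0 < b2 ∧
      ¬ ∃ (Q : ℝ × ℝ → ℝ × ℝ → ℕ × ℕ) (P : ℝ × ℝ → ℝ × ℝ → ℝ × ℝ),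
        -- the mechanism always outputs a feasible outcome
        (∀ v1 v2, Dim v1 → Dim v2 →
          (Q v1 v2).1 + (Q v1 v2).2 ≤ 2 ∧ (P v1 v2).1 ≤ b1 ∧ (P v1 v2).2 ≤ b2) ∧
        -- bidder rationality
        (∀ v1 v2, Dim v1 → Dim v2 →
          0 ≤ val2 v1 (Q v1 v2).1 - (P v1 v2).1 ∧
          0 ≤ val2 v2 (Q v1 v2).2 - (P v1 v2).2) ∧
        -- auctioneer rationality
        (∀ v1 v2, Dim v1 → Dim v2 → 0 ≤ (P v1 v2).1 + (P v1 v2).2) ∧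
        -- no positive transfers
        (∀ v1 v2, Dim v1 → Dim v2 → 0 ≤ (P v1 v2).1 ∧ 0 ≤ (P v1 v2).2) ∧
        -- incentive compatibility for bidder 1
        (∀ v1 v1' v2, Dim v1 → Dim v1' → Dim v2 →
          val2 v1 (Q v1' v2).1 - (P v1' v2).1 ≤
            val2 v1 (Q v1 v2).1 - (P v1 v2).1) ∧
        -- incentive compatibility for bidder 2
        (∀ v1 v2 v2', Dim v1 → Dim v2 → Dim v2' →
          val2 v2 (Q v1 v2').2 - (P v1 v2').2 ≤
            val2 v2 (Q v1 v2).2 - (P v1 v2).2) ∧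
        -- Pareto optimality of every produced outcome
        (∀ v1 v2, Dim v1 → Dim v2 →
          ¬ ∃ (q' : ℕ × ℕ) (p' : ℝ × ℝ),
            q'.1 + q'.2 ≤ 2 ∧ p'.1 ≤ b1 ∧ p'.2 ≤ b2 ∧
            val2 v1 (Q v1 v2).1 - (P v1 v2).1 ≤ val2 v1 q'.1 - p'.1 ∧
            val2 v2 (Q v1 v2).2 - (P v1 v2).2 ≤ val2 v2 q'.2 - p'.2 ∧
            (P v1 v2).1 + (P v1 v2).2 ≤ p'.1 + p'.2 ∧
            (val2 v1 (Q v1 v2).1 - (P v1 v2).1 < val2 v1 q'.1 - p'.1 ∨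
             val2 v2 (Q v1 v2).2 - (P v1 v2).2 < val2 v2 q'.2 - p'.2 ∨
             (P v1 v2).1 + (P v1 v2).2 < p'.1 + p'.2)) := by
  refine ⟨3, 11, by norm_num, by norm_num, ?_⟩
  rintro ⟨Q, P, hF, hR, -, hN, hI1, hI2, hPO⟩
  have cases6 : ∀ q : ℕ × ℕ, q.1 + q.2 ≤ 2 → q = (0,0) ∨ q = (0,1) ∨ q = (0,2) ∨
      q = (1,0) ∨ q = (1,1) ∨ q = (2,0) := by
    rintro ⟨a, b⟩ h
    simp only [Prod.mk.injEq] at *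
    omega
  have d10 : Dim (10, 10) := by constructor <;> norm_num
  have dA : Dim (1.55, 1.55) := by constructor <;> norm_num
  have dB : Dim (1.6, 1.6) := by constructor <;> norm_num
  have dC : Dim (1.7, 1) := by constructor <;> norm_num
  have dD : Dim (1.1, 0) := by constructor <;> norm_num
  -- low bidder 1 gets no item against `(1.6, 1.6)`
  have hA : (Q (1.55, 1.55) (1.6, 1.6)).1 = 0 := by
    have f := hF _ _ dA dB
    have r := hR _ _ dA dB
    have n := hN _ _ dA dB
    have po := hPO _ _ dA dB
    generalize P (1.55, 1.55) (1.6, 1.6) = p at *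
    rcases cases6 _ f.1 with h | h | h | h | h | h <;> rw [h] at r po ⊢ <;>
      simp only [val2] at r po
    · exfalso
      refine po ⟨(1, 1), p, ?_⟩
      simp only [val2]; norm_num; exact ⟨f.2.1, f.2.2⟩
    · exfalso
      refine po ⟨(0, 2), (p.1 - 1.55, p.2 + 1.55), ?_⟩
      simp only [val2]
      refine ⟨by norm_num, ?_, ?_, ?_, ?_, ?_, Or.inr (Or.inl ?_)⟩ <;> linarith
    · exfalso
      refine po ⟨(1, 1), (p.1 - 1.55, p.2 + 1.55), ?_⟩
      simp only [val2]
      refine ⟨by norm_num, ?_, ?_, ?_, ?_, ?_, Or.inr (Or.inl ?_)⟩ <;> linarith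
  -- at `((10,10),(1.6,1.6))` each bidder gets one item
  have hB : (Q (10, 10) (1.6, 1.6)).2 = 1 ∧ (P (10, 10) (1.6, 1.6)).2 ≤ 1.6 := by
    have f := hF _ _ d10 dB
    have r := hR _ _ d10 dB
    have n := hN _ _ d10 dB
    have po := hPO _ _ d10 dB
    have ic := hI1 _ _ _ dA d10 dB
    have nA := (hN _ _ dA dB).1
    rw [hA] at ic
    generalize P (10, 10) (1.6, 1.6) = p at *
    rcases cases6 _ f.1 with h | h | h | h | h | h <;> rw [h] at r po ic ⊢ <;>
      simp only [val2] at r po ic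
    · exfalso
      refine po ⟨(1, 0), p, ?_⟩
      simp only [val2]; norm_num; exact ⟨f.2.1, f.2.2⟩
    · exfalso
      refine po ⟨(1, 1), p, ?_⟩
      simp only [val2]; norm_num; exact ⟨f.2.1, f.2.2⟩
    · exfalso
      refine po ⟨(1, 1), (p.1 + 1.6, p.2 - 1.6), ?_⟩
      simp only [val2]
      refine ⟨by norm_num, ?_, ?_, ?_, ?_, ?_, Or.inl ?_⟩ <;> linarith
    · exfalso
      refine po ⟨(1, 1), p, ?_⟩
      simp only [val2]; norm_num; exact ⟨f.2.1, f.2.2⟩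
    · exact ⟨rfl, by linarith⟩
    · exfalso
      linarith
  -- bidder 1 with `(1.1, 0)` gets one item against `(1.7, 1)`
  have hD : (Q (1.1, 0) (1.7, 1)).1 = 1 ∧ (P (1.1, 0) (1.7, 1)).1 ≤ 1.1 := by
    have f := hF _ _ dD dC
    have r := hR _ _ dD dC
    have n := hN _ _ dD dC
    have po := hPO _ _ dD dC
    generalize P (1.1, 0) (1.7, 1) = p at *
    rcases cases6 _ f.1 with h | h | h | h | h | h <;> rw [h] at r po ⊢ <;>
      simp only [val2] at r po
    · exfalso
      refine po ⟨(1, 0), p, ?_⟩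
      simp only [val2]; norm_num; exact ⟨f.2.1, f.2.2⟩
    · exfalso
      refine po ⟨(1, 1), p, ?_⟩
      simp only [val2]; norm_num; exact ⟨f.2.1, f.2.2⟩
    · exfalso
      refine po ⟨(1, 1), (p.1 + 1, p.2 - 1), ?_⟩
      simp only [val2]
      refine ⟨by norm_num, ?_, ?_, ?_, ?_, ?_, Or.inl ?_⟩ <;> linarith
    · exact ⟨rfl, by linarith⟩
    · exact ⟨rfl, by linarith⟩
    · exfalso
      refine po ⟨(1, 1), p, ?_⟩
      simp only [val2]; norm_num; exact ⟨f.2.1, f.2.2⟩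
  -- the contradiction at `((10,10),(1.7,1))`
  have f := hF _ _ d10 dC
  have r := hR _ _ d10 dC
  have n := hN _ _ d10 dC
  have po := hPO _ _ d10 dC
  have ic1 := hI1 _ _ _ d10 dD dC
  have ic2 := hI2 _ _ _ d10 dC dB
  rw [hD.1] at ic1
  rw [hB.1] at ic2
  have hB2 := hB.2
  have hD2 := hD.2
  generalize P (10, 10) (1.7, 1) = p at *
  rcases cases6 _ f.1 with h | h | h | h | h | h <;> rw [h] at r po ic1 ic2 <;>
    simp only [val2] at r po ic1 ic2
  · linarith
  · refine po ⟨(1, 1), p, ?_⟩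
    simp only [val2]; norm_num; exact ⟨f.2.1, f.2.2⟩
  · refine po ⟨(1, 1), (p.1 + 1, p.2 - 1), ?_⟩
    simp only [val2]
    refine ⟨by norm_num, ?_, ?_, ?_, ?_, ?_, Or.inl ?_⟩ <;> linarith
  · linarith
  · refine po ⟨(2, 0), (p.1 + 1.7, p.2 - 1.7), ?_⟩
    simp only [val2]
    refine ⟨by norm_num, ?_, ?_, ?_, ?_, ?_, Or.inl ?_⟩ <;> linarith
  · linarith
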